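/- Let F be a finite field with q elements, ψ a nontrivial additive character of F, n ≥ 1, and π an irreducible generic complex representation of GL_n(F). Then for every g ∈ GL_n(F): J_{π,ψ}(g) · ψ((g^{-1})_{n,1}) = (|U_n|/|GL_n(F)|) · Σ_σ dim(σ) · ( |U_n|^{-1} · Σ_{h ∈ GL_n(F)} J_{π,ψ}(h) · conj(J_{σ,ψ}(h)) · ψ((h^{-1})_{n,1}) ) · J_{σ,ψ}(g), where σ runs over the isomorphism classes of irreducible generic representations of GL_n(F), (g^{-1})_{n,1} denotes the (n,1) entry of the inverse matrix, and conj denotes complex conjugation. -/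

import Mathlib

noncomputable section

open scoped BigOperators

/-- The predicate of being an upper unitriangular matrix. -/
def IsUnipUpper {F : Type} [Field F] {N : ℕ} (u : Matrix (Fin N) (Fin N) F) : Prop :=
  (∀ i, u i i = 1) ∧ ∀ i j : Fin N, (j : ℕ) < (i : ℕ) → u i j = 0

/-- The extension of an additive character `ψ` to (unitriangular) matrices:
`u ↦ ψ (u 1 2 + u 2 3 + ⋯)`. -/
def psiU {F : Type} [Field F] (ψ : AddChar F ℂ) {N : ℕ} (u : Matrix (Fin N) (Fin N) F) : ℂ :=
  ψ (∑ i : Fin (N - 1),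
      u ⟨(i : ℕ), lt_of_lt_of_le i.isLt (Nat.sub_le N 1)⟩
        ⟨(i : ℕ) + 1, by have := i.isLt; omega⟩)

/-- A finite-dimensional complex (matrix) representation of `GL_N(F)`. -/
structure FinRep (N : ℕ) (F : Type) [Field F] where
  d : ℕ
  ρ : (Matrix (Fin N) (Fin N) F)ˣ →* (Matrix (Fin d) (Fin d) ℂ)ˣ

/-- Irreducibility: the space is nonzero and has no nontrivial invariant subspace. -/
def FinRep.Irreducible {N : ℕ} {F : Type} [Field F] (π : FinRep N F) : Prop :=
  0 < π.d ∧ ∀ W : Submodule ℂ (Fin π.d → ℂ),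
    (∀ g : (Matrix (Fin N) (Fin N) F)ˣ, ∀ v ∈ W,
        ((π.ρ g : Matrix (Fin π.d) (Fin π.d) ℂ)).mulVec v ∈ W) →
      W = ⊥ ∨ W = ⊤

/-- Genericity: there is a nonzero `ψ`-Whittaker functional. -/
def FinRep.Generic {N : ℕ} {F : Type} [Field F] (ψ : AddChar F ℂ) (π : FinRep N F) : Prop :=
  ∃ ℓ : (Fin π.d → ℂ) →ₗ[ℂ] ℂ, ℓ ≠ 0 ∧
    ∀ u : (Matrix (Fin N) (Fin N) F)ˣ, IsUnipUpper (u : Matrix (Fin N) (Fin N) F) →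
      ∀ v : Fin π.d → ℂ,
        ℓ (((π.ρ u : Matrix (Fin π.d) (Fin π.d) ℂ)).mulVec v) =
          psiU ψ (u : Matrix (Fin N) (Fin N) F) * ℓ v

/-- Isomorphism of two such representations. -/
def FinRep.Iso {N : ℕ} {F : Type} [Field F] (π σ : FinRep N F) : Prop :=
  ∃ e : (Fin π.d → ℂ) ≃ₗ[ℂ] (Fin σ.d → ℂ),
    ∀ (g : (Matrix (Fin N) (Fin N) F)ˣ) (v : Fin π.d → ℂ),
      e (((π.ρ g : Matrix (Fin π.d) (Fin π.d) ℂ)).mulVec v) =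
        ((σ.ρ g : Matrix (Fin σ.d) (Fin σ.d) ℂ)).mulVec (e v)

open scoped Classical in
/-- The set `U_N` of upper unitriangular matrices. -/
def unipFinset (F : Type) [Field F] [Fintype F] (N : ℕ) :
    Finset (Matrix (Fin N) (Fin N) F) :=
  Finset.univ.filter IsUnipUpper

open scoped Classical in
/-- The trace character of `π`, extended by zero to all matrices. -/
def traceChar {F : Type} [Field F] {N : ℕ} (π : FinRep N F) (A : Matrix (Fin N) (Fin N) F) : ℂ :=
  if h : IsUnit A then Matrix.trace ((π.ρ h.unit : Matrix (Fin π.d) (Fin π.d) ℂ)) else 0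

/-- The normalized Bessel function of `π` (S. I. Gelfand's formula), extended by zero to
all matrices. -/
def Bessel {F : Type} [Field F] [Fintype F] {N : ℕ}
    (ψ : AddChar F ℂ) (π : FinRep N F) (A : Matrix (Fin N) (Fin N) F) : ℂ :=
  ((unipFinset F N).card : ℂ)⁻¹ *
    ∑ u ∈ unipFinset F N, (psiU ψ u)⁻¹ * traceChar π (A * u)

/-- The `N × N` block matrix with `a·I_{N-M}` in the upper-right corner, an `M × M` matrix `h`
in the lower-left corner, and zero blocks elsewhere. -/
def cornerBlock (F : Type) [Field F] (N M : ℕ) (a : F) (h : Matrix (Fin M) (Fin M) F) :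
    Matrix (Fin N) (Fin N) F :=
  fun i j =>
    if (i : ℕ) < N - M then (if (j : ℕ) = (i : ℕ) + M then a else 0)
    else if hi : (i : ℕ) - (N - M) < M then
      (if hj : (j : ℕ) < M then h ⟨(i : ℕ) - (N - M), hi⟩ ⟨(j : ℕ), hj⟩ else 0)
    else 0

end

section Unipotent

variable {F : Type} [Field F] {n : ℕ}

theorem IsUnipUpper.one : IsUnipUpper (1 : Matrix (Fin n) (Fin n) F) := by
  refine ⟨fun i => by simp, fun i j h => ?_⟩
  rw [Matrix.one_apply_ne]
  rintro rfl
  exact lt_irrefl _ h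

theorem IsUnipUpper.mul {u v : Matrix (Fin n) (Fin n) F} (hu : IsUnipUpper u)
    (hv : IsUnipUpper v) : IsUnipUpper (u * v) := by
  refine ⟨fun i => ?_, fun i j h => ?_⟩
  · rw [Matrix.mul_apply, Finset.sum_eq_single i]
    · rw [hu.1, hv.1, one_mul]
    · intro k _ hk
      rcases lt_or_gt_of_ne (Fin.val_ne_of_ne hk) with h | h
      · rw [hu.2 _ _ h, zero_mul]
      · rw [hv.2 _ _ h, mul_zero]
    · simp
  · rw [Matrix.mul_apply]
    refine Finset.sum_eq_zero fun k _ => ?_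
    rcases lt_or_ge (k : ℕ) i with h' | h'
    · rw [hu.2 _ _ h', zero_mul]
    · rw [hv.2 _ _ (by omega), mul_zero]

theorem IsUnipUpper.det {u : Matrix (Fin n) (Fin n) F} (hu : IsUnipUpper u) : u.det = 1 := by
  rw [Matrix.det_of_isUpperTriangular (fun i j h => hu.2 i j h)]
  simp [hu.1]

theorem IsUnipUpper.exists_unit {u : Matrix (Fin n) (Fin n) F} (hu : IsUnipUpper u) :
    ∃ v : (Matrix (Fin n) (Fin n) F)ˣ, (v : Matrix (Fin n) (Fin n) F) = u :=
  (Matrix.isUnit_iff_isUnit_det u).2 (by rw [hu.det]; exact isUnit_one)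

/-- The inverse of a unitriangular matrix over a finite field is unitriangular, being a
power of it. -/
theorem IsUnipUpper.inv [Fintype F] {u : (Matrix (Fin n) (Fin n) F)ˣ}
    (hu : IsUnipUpper (u : Matrix (Fin n) (Fin n) F)) :
    IsUnipUpper ((u⁻¹ : (Matrix (Fin n) (Fin n) F)ˣ) : Matrix (Fin n) (Fin n) F) := by
  classical
  have hpow : ∀ k : ℕ, IsUnipUpper ((u ^ k : (Matrix (Fin n) (Fin n) F)ˣ) :
      Matrix (Fin n) (Fin n) F) := by
    intro k
    induction k with
    | zero => simpa using IsUnipUpper.one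
    | succ k ih => rw [pow_succ, Units.val_mul]; exact ih.mul hu
  have : u⁻¹ = u ^ (orderOf u - 1) := by
    rw [inv_eq_iff_mul_eq_one, ← pow_succ',
      Nat.sub_add_cancel (orderOf_pos u), pow_orderOf_eq_one]
  rw [this]
  exact hpow _

theorem psiU_mul (ψ : AddChar F ℂ) {u v : Matrix (Fin n) (Fin n) F} (hu : IsUnipUpper u)
    (hv : IsUnipUpper v) : psiU ψ (u * v) = psiU ψ u * psiU ψ v := by
  unfold psiU
  rw [← AddChar.map_add_eq_mul, ← Finset.sum_add_distrib]
  congr 1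
  refine Finset.sum_congr rfl fun i _ => ?_
  have hi := i.isLt
  rw [Matrix.mul_apply, Finset.sum_eq_add (⟨i, by omega⟩ : Fin n) ⟨(i : ℕ) + 1, by omega⟩]
  · rw [hu.1, hv.1, one_mul, mul_one, add_comm]
  · simp [Fin.ext_iff]
  · rintro k - ⟨h1, h2⟩
    rw [Ne, Fin.ext_iff] at h1 h2
    simp only at h1 h2
    rcases lt_or_gt_of_ne h1 with h | h
    · rw [hu.2 _ _ (by exact h), zero_mul]
    · rw [hv.2 _ _ (by simp only; omega), mul_zero]
  · simp
  · simp

theorem psiU_one (ψ : AddChar F ℂ) : psiU ψ (1 : Matrix (Fin n) (Fin n) F) = 1 := by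
  unfold psiU
  rw [Finset.sum_eq_zero, AddChar.map_zero_eq_one]
  intro i _
  rw [Matrix.one_apply_ne]
  simp [Fin.ext_iff]

theorem AddChar.apply_ne_zero {A : Type*} [AddGroup A] (ψ : AddChar A ℂ) (a : A) : ψ a ≠ 0 :=
  left_ne_zero_of_mul_eq_one (b := ψ (-a)) (by rw [← AddChar.map_add_eq_mul, add_neg_cancel,
    AddChar.map_zero_eq_one])

theorem psiU_ne_zero (ψ : AddChar F ℂ) (u : Matrix (Fin n) (Fin n) F) : psiU ψ u ≠ 0 :=
  ψ.apply_ne_zero _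

theorem psiU_inv [Fintype F] (ψ : AddChar F ℂ) {u : (Matrix (Fin n) (Fin n) F)ˣ}
    (hu : IsUnipUpper (u : Matrix (Fin n) (Fin n) F)) :
    psiU ψ ((u⁻¹ : (Matrix (Fin n) (Fin n) F)ˣ) : Matrix (Fin n) (Fin n) F)
      = (psiU ψ (u : Matrix (Fin n) (Fin n) F))⁻¹ := by
  rw [← mul_eq_one_iff_eq_inv₀ (psiU_ne_zero ψ _), ← psiU_mul ψ hu.inv hu, ← Units.val_mul,
    inv_mul_cancel, Units.val_one, psiU_one]

/-- Transposition along the antidiagonal. -/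
def antiTranspose (A : Matrix (Fin n) (Fin n) F) : Matrix (Fin n) (Fin n) F :=
  Matrix.of fun i j => A j.rev i.rev

omit [Field F] in
theorem antiTranspose_apply (A : Matrix (Fin n) (Fin n) F) (i j : Fin n) :
    antiTranspose A i j = A j.rev i.rev := rfl

omit [Field F] in
theorem antiTranspose_antiTranspose (A : Matrix (Fin n) (Fin n) F) :
    antiTranspose (antiTranspose A) = A := by
  ext i j
  simp [antiTranspose_apply]

theorem antiTranspose_mul (A B : Matrix (Fin n) (Fin n) F) :
    antiTranspose (A * B) = antiTranspose B * antiTranspose A := by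
  ext i j
  rw [antiTranspose_apply, Matrix.mul_apply, Matrix.mul_apply, ← Equiv.sum_comp Fin.revPerm]
  refine Finset.sum_congr rfl fun k _ => ?_
  simp [antiTranspose_apply, mul_comm]

theorem antiTranspose_one : antiTranspose (1 : Matrix (Fin n) (Fin n) F) = 1 := by
  ext i j
  simp [antiTranspose_apply, Matrix.one_apply, eq_comm]

/-- Transposition along the antidiagonal, on invertible matrices. -/
def unitAntiTranspose (g : (Matrix (Fin n) (Fin n) F)ˣ) : (Matrix (Fin n) (Fin n) F)ˣ where
  val := antiTranspose g
  inv := antiTranspose (g⁻¹ : (Matrix (Fin n) (Fin n) F)ˣ)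
  val_inv := by rw [← antiTranspose_mul, ← Units.val_mul]; simp [antiTranspose_one]
  inv_val := by rw [← antiTranspose_mul, ← Units.val_mul]; simp [antiTranspose_one]

theorem unitAntiTranspose_unitAntiTranspose (g : (Matrix (Fin n) (Fin n) F)ˣ) :
    unitAntiTranspose (unitAntiTranspose g) = g :=
  Units.ext (antiTranspose_antiTranspose _)

theorem unitAntiTranspose_mul (g h : (Matrix (Fin n) (Fin n) F)ˣ) :
    unitAntiTranspose (g * h) = unitAntiTranspose h * unitAntiTranspose g :=
  Units.ext (antiTranspose_mul _ _)

theorem IsUnipUpper.antiTranspose {u : Matrix (Fin n) (Fin n) F} (hu : IsUnipUpper u) :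
    IsUnipUpper (antiTranspose u) := by
  refine ⟨fun i => hu.1 _, fun i j h => hu.2 _ _ ?_⟩
  rw [Fin.val_rev, Fin.val_rev]
  omega

theorem psiU_antiTranspose (ψ : AddChar F ℂ) (u : Matrix (Fin n) (Fin n) F) :
    psiU ψ (antiTranspose u) = psiU ψ u := by
  unfold psiU
  rw [← Equiv.sum_comp Fin.revPerm]
  congr 1
  refine Finset.sum_congr rfl fun i _ => ?_
  have hi := i.isLt
  rw [antiTranspose_apply]
  congr 1 <;> ext <;> simp [Fin.val_rev] <;> omega

end Unipotent

section Bruhat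

variable {F : Type} [Field F] {n : ℕ}

/-- Column `j` of `A` has a single nonzero entry, which is also the only nonzero entry of its
row. -/
def IsMonomialColumn (A : Matrix (Fin n) (Fin n) F) (j : Fin n) : Prop :=
  ∃ r, A r j ≠ 0 ∧ (∀ i, i ≠ r → A i j = 0) ∧ ∀ l, l ≠ j → A r l = 0

theorem exists_unipUpper_mul_clear {A : Matrix (Fin n) (Fin n) F} {r k : Fin n}
    (hrk : A r k ≠ 0) (hlow : ∀ i, r < i → A i k = 0) (hleft : ∀ j, j < k → A r j = 0) :
    ∃ u B v : Matrix (Fin n) (Fin n) F, IsUnipUpper u ∧ IsUnipUpper v ∧ A = u * B * v ∧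
      ∀ i j, B i j = A i j - A i k * A r j / A r k + if i = r ∧ j = k then A r k else 0 := by
  classical
  set c := A r k with hc
  set B : Matrix (Fin n) (Fin n) F := Matrix.of (fun i j => A i j - A i k * A r j / c +
        if i = r ∧ j = k then c else 0) with hB
  have hBr : ∀ j, B r j = if j = k then c else 0 := by
    intro j
    rw [hB, Matrix.of_apply, ← hc]
    simp only [true_and]
    field_simp
    ring
  have hBk : ∀ i, B i k = if i = r then c else 0 := by
    intro i
    rw [hB, Matrix.of_apply, ← hc]
    simp only [and_true]
    field_simp
    ring
  refine ⟨1 + Matrix.vecMulVec (fun i => if i = r then 0 else A i k / c) (Pi.single r 1), B,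
    1 + Matrix.vecMulVec (Pi.single k 1) (fun j => if j = k then 0 else A r j / c), ?_, ?_, ?_,
    fun _ _ => rfl⟩
  · refine ⟨fun i => ?_, fun i j h => ?_⟩
    · by_cases hi : i = r <;> simp [Matrix.vecMulVec_apply, hi]
    · have hij : i ≠ j := by rintro rfl; exact lt_irrefl _ h
      by_cases hj : j = r
      · subst hj
        simp [Matrix.vecMulVec_apply, Matrix.one_apply_ne hij, hij, hlow i h]
      · simp [Matrix.vecMulVec_apply, Matrix.one_apply_ne hij, hj]
  · refine ⟨fun i => ?_, fun i j h => ?_⟩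
    · by_cases hi : i = k <;> simp [Matrix.vecMulVec_apply, hi]
    · have hij : i ≠ j := by rintro rfl; exact lt_irrefl _ h
      by_cases hi : i = k
      · subst hi
        simp [Matrix.vecMulVec_apply, Matrix.one_apply_ne hij, hij.symm, hleft j h]
      · simp [Matrix.vecMulVec_apply, Matrix.one_apply_ne hij, hi]
  · have h1 : ∀ i j, ((1 + Matrix.vecMulVec (fun i => if i = r then 0 else A i k / c)
        (Pi.single r 1)) * B) i j = B i j + (if i = r then 0 else A i k / c) * B r j := by
      intro i j
      simp [add_mul, Matrix.vecMulVec_mul, Matrix.vecMulVec_apply]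
    ext i j
    have h2 : ∀ C : Matrix (Fin n) (Fin n) F, (C * (1 + Matrix.vecMulVec (Pi.single k 1)
        (fun j => if j = k then 0 else A r j / c))) i j =
        C i j + C i k * (if j = k then 0 else A r j / c) := by
      intro C
      simp [mul_add, Matrix.mul_vecMulVec, Matrix.vecMulVec_apply]
    rw [h2, h1, h1, hBr, hBr, hBk]
    by_cases hi : i = r <;> by_cases hj : j = k <;> simp [hi, hj, hB, ← hc] <;> field_simp <;>
      ring

theorem exists_monomialColumn_lt {g : Matrix (Fin n) (Fin n) F} (hg : g.det ≠ 0) (k : ℕ)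
    (hk : k ≤ n) :
    ∃ u m v : Matrix (Fin n) (Fin n) F, IsUnipUpper u ∧ IsUnipUpper v ∧ g = u * m * v ∧
      ∀ j : Fin n, (j : ℕ) < k → IsMonomialColumn m j := by
  classical
  induction k with
  | zero => exact ⟨1, g, 1, .one, .one, by simp, fun j h => absurd h (Nat.not_lt_zero _)⟩
  | succ k ih =>
    obtain ⟨u, m, v, hu, hv, rfl, hm⟩ := ih (by omega)
    have hdet : m.det ≠ 0 := by
      rw [Matrix.det_mul, Matrix.det_mul, hu.det, hv.det] at hg
      simpa using hg
    set K : Fin n := ⟨k, by omega⟩ with hK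
    have hne : ∃ r, m r K ≠ 0 := by
      by_contra! h
      exact hdet (Matrix.det_eq_zero_of_column_eq_zero K h)
    have hne' : (Finset.univ.filter fun r => m r K ≠ 0).Nonempty := by
      obtain ⟨r, hr⟩ := hne
      exact ⟨r, by simpa using hr⟩
    obtain ⟨r, hr, hmax⟩ := Finset.exists_max_image _ (fun r : Fin n => r) hne'
    simp only [Finset.mem_filter, Finset.mem_univ, true_and] at hr hmax
    have hlow : ∀ i, r < i → m i K = 0 := by
      intro i hi
      by_contra h
      exact absurd (hmax i h) (not_le.2 hi)
    have hleft : ∀ j, j < K → m r j = 0 := by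
      intro j hj
      obtain ⟨s, hs, hcol, hrow⟩ := hm j hj
      refine hcol r ?_
      rintro rfl
      exact hr (hrow K hj.ne')
    obtain ⟨u', B, v', hu', hv', hm', hB⟩ := exists_unipUpper_mul_clear hr hlow hleft
    refine ⟨u * u', B, v' * v, hu.mul hu', hv'.mul hv, ?_, ?_⟩
    · rw [hm']
      simp only [Matrix.mul_assoc]
    · intro j hj
      by_cases hjk : j = K
      · subst hjk
        refine ⟨r, ?_, ?_, ?_⟩
        · simp [hB, hr]
        · intro i hi
          simp [hB, hi, hr]
        · intro l hl
          simp [hB, hl, hr]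
      · have hj' : j < K := by
          rw [Fin.lt_def]
          have : (j : ℕ) ≠ k := fun h => hjk (Fin.ext h)
          simp only [hK]; omega
        obtain ⟨s, hs, hcol, hrow⟩ := hm j hj'
        have hsK : m s K = 0 := hrow K hj'.ne'
        have hsr : s ≠ r := by rintro rfl; exact hr hsK
        refine ⟨s, ?_, ?_, ?_⟩
        · simpa [hB, hsK, hsr] using hs
        · intro i hi
          simp [hB, hcol i hi, hleft j hj', hjk]
        · intro l hl
          simp [hB, hrow l hl, hsK, hsr]

/-- The Bruhat decomposition, in terms of a monomial matrix. -/
theorem exists_bruhat (g : (Matrix (Fin n) (Fin n) F)ˣ) :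
    ∃ u m v : (Matrix (Fin n) (Fin n) F)ˣ, IsUnipUpper (u : Matrix (Fin n) (Fin n) F) ∧
      IsUnipUpper (v : Matrix (Fin n) (Fin n) F) ∧ g = u * m * v ∧
      ∃ (w : Fin n → Fin n) (c : Fin n → F), Function.Injective w ∧ (∀ j, c j ≠ 0) ∧
        (m : Matrix (Fin n) (Fin n) F) = Matrix.of fun i j => if i = w j then c j else 0 := by
  have hdet : (g : Matrix (Fin n) (Fin n) F).det ≠ 0 :=
    ((Matrix.isUnit_iff_isUnit_det _).1 g.isUnit).ne_zero
  obtain ⟨u, m, v, hu, hv, hg, hm⟩ := exists_monomialColumn_lt hdet n le_rfl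
  obtain ⟨u, rfl⟩ := hu.exists_unit
  obtain ⟨v, rfl⟩ := hv.exists_unit
  have hm' : m = (u⁻¹ * g * v⁻¹ : (Matrix (Fin n) (Fin n) F)ˣ) := by
    simp [hg, Matrix.mul_assoc]
  choose w hw hcol hrow using fun j => hm j j.isLt
  refine ⟨u, u⁻¹ * g * v⁻¹, v, hu, hv, by group, w, fun j => m (w j) j, ?_, hw, ?_⟩
  · intro i j hij
    by_contra h
    exact hw i (by rw [hij]; exact hrow j i h)
  · rw [← hm']
    ext i j
    rw [Matrix.of_apply]
    split_ifs with h
    · rw [h]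
    · exact hcol j i h

end Bruhat

section Gelfand

/-- If every step of an injective sequence is an ascent or a descent by one (with `c` constant
along descents), then all the steps between the two ends of an inversion are descents. -/
theorem eq_of_inversion {n : ℕ} {α : Type*} {φ : Fin n → Fin n} (hφ : Function.Injective φ)
    {c : Fin n → α}
    (H : ∀ i j : Fin n, (i : ℕ) + 1 = j → φ i < φ j ∨ ((φ j : ℕ) + 1 = φ i ∧ c j = c i))
    (d : ℕ) (p q : Fin n) (hd : (p : ℕ) + d = q) (hpq : p < q) (hlt : φ q < φ p)
    (r : Fin n) (hr : p ≤ r) (hr' : r ≤ q) : (φ r : ℕ) + r = φ p + p ∧ c r = c p := by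
  induction d generalizing p r with
  | zero => exact absurd hpq (by rw [Fin.lt_def]; omega)
  | succ d ih =>
    have hq := q.isLt
    rcases eq_or_lt_of_le hr with rfl | hr1
    · exact ⟨rfl, rfl⟩
    rw [Fin.lt_def] at hr1 hpq hlt
    rw [Fin.le_def] at hr'
    set s : Fin n := ⟨p + 1, by omega⟩ with hs
    have hsv : (s : ℕ) = p + 1 := rfl
    rcases H p s rfl with h | ⟨h, hc⟩
    · exfalso
      rw [Fin.lt_def] at h
      have hsq : s < q := by
        rw [Fin.lt_def]
        rcases Nat.lt_or_ge s q with h' | h'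
        · exact h'
        · have : s = q := Fin.ext (by omega)
          rw [this] at h
          omega
      have key := fun t h1 h2 => (ih s (by omega) hsq (by rw [Fin.lt_def]; omega) t h1 h2).1
      have hqk := key q hsq.le le_rfl
      have ht := key ⟨s + (φ s - φ p), by omega⟩ (by rw [Fin.le_def]; simp)
        (by rw [Fin.le_def]; simp only; omega)
      simp only at ht
      have := hφ (Fin.ext (by omega) : φ ⟨s + (φ s - φ p), by omega⟩ = φ p)
      rw [Fin.ext_iff] at this
      simp only at this
      omega
    · by_cases hsq : s < q
      · have hne : (φ q : ℕ) ≠ φ s := fun h => hsq.ne' (hφ (Fin.ext h))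
        have := ih s (by omega) hsq (by rw [Fin.lt_def]; omega) r (by rw [Fin.le_def]; omega)
          (by rw [Fin.le_def]; omega)
        refine ⟨by omega, this.2.trans hc⟩
      · rw [Fin.lt_def] at hsq
        have : r = s := Fin.ext (by omega)
        rw [this]
        exact ⟨by omega, hc⟩

theorem involutive_of_ascent_or_descent_by_one {n : ℕ} {α : Type*} {φ : Fin n → Fin n}
    (hφ : Function.Injective φ) {c : Fin n → α}
    (H : ∀ i j : Fin n, (i : ℕ) + 1 = j → φ i < φ j ∨ ((φ j : ℕ) + 1 = φ i ∧ c j = c i))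
    (j : Fin n) : φ (φ j) = j ∧ c (φ j) = c j := by
  classical
  have inv := fun (p q : Fin n) (hpq : p < q) => eq_of_inversion hφ H (q - p) p q
    (by rw [Fin.lt_def] at hpq; omega) hpq
  obtain ⟨m, hm⟩ : ∃ m, φ j = m := ⟨_, rfl⟩
  rw [hm]
  rcases lt_trichotomy j m with hjm | rfl | hjm
  · rcases lt_or_ge (φ m) m with h | h
    · obtain ⟨h1, h2⟩ := inv j m hjm (by rw [hm]; exact h) m hjm.le le_rfl
      rw [hm] at h1
      exact ⟨Fin.ext (by omega), h2⟩
    · exfalso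
      have hmap : ∀ r ∈ Finset.Ici m, φ r ∈ Finset.Ioi m := by
        intro r hr
        rw [Finset.mem_Ici] at hr
        rw [Finset.mem_Ioi]
        by_contra hlt
        have hne : φ r ≠ m := by
          rw [← hm]
          exact fun h => (hjm.trans_le hr).ne' (hφ h)
        have h1 := (inv j r (hjm.trans_le hr) (by rw [hm]; exact lt_of_le_of_ne (not_lt.1 hlt) hne)
          m hjm.le hr).1
        rw [hm] at h1
        rw [Fin.lt_def] at hjm
        rw [Fin.le_def] at h
        omega
      have := Finset.card_le_card_of_injOn φ hmap hφ.injOn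
      rw [Fin.card_Ici, Fin.card_Ioi] at this
      have := m.isLt
      omega
  · exact ⟨hm, rfl⟩
  · rcases lt_or_ge m (φ m) with h | h
    · obtain ⟨h1, h2⟩ := inv m j hjm (by rw [hm]; exact h) j hjm.le le_rfl
      rw [hm] at h1
      exact ⟨Fin.ext (by omega), h2.symm⟩
    · exfalso
      have hmap : ∀ r ∈ Finset.Iic m, φ r ∈ Finset.Iio m := by
        intro r hr
        rw [Finset.mem_Iic] at hr
        rw [Finset.mem_Iio]
        by_contra hlt
        have hrj : r < j := hr.trans_lt hjm
        have hne : φ r ≠ m := by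
          rw [← hm]
          exact fun h => hrj.ne (hφ h)
        have hi := inv r j hrj (by rw [hm]; exact lt_of_le_of_ne (not_lt.1 hlt) hne.symm)
        have h1 := (hi m hr hjm.le).1
        have h2 := (hi j hrj.le le_rfl).1
        rw [hm] at h2
        rw [Fin.lt_def] at hjm
        rw [Fin.le_def] at h
        omega
      have := Finset.card_le_card_of_injOn φ hmap hφ.injOn
      rw [Fin.card_Iic, Fin.card_Iio] at this
      omega

variable {F : Type} [Field F] {n : ℕ}

theorem isUnipUpper_transvection {i j : Fin n} (hij : i < j) (a : F) :
    IsUnipUpper (1 + Matrix.single i j a) := by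
  refine ⟨fun k => ?_, fun k l h => ?_⟩
  · have : ¬ (i = k ∧ j = k) := by rintro ⟨rfl, rfl⟩; exact lt_irrefl _ hij
    simp [this]
  · have h1 : ¬ (i = k ∧ j = l) := by
      rintro ⟨rfl, rfl⟩
      rw [Fin.lt_def] at hij
      omega
    have h2 : k ≠ l := by rintro rfl; exact lt_irrefl _ h
    simp [h1, h2]

theorem psiU_transvection (ψ : AddChar F ℂ) {i j : Fin n} (a : F) :
    psiU ψ (1 + Matrix.single i j a) = if (i : ℕ) + 1 = j then ψ a else 1 := by
  unfold psiU
  have hj := j.isLt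
  split_ifs with h
  · rw [Finset.sum_eq_single (⟨i, by omega⟩ : Fin (n - 1))]
    · congr 1
      have : (i : ℕ) ≠ j := by omega
      simp [Fin.ext_iff, h, this]
    · intro k _ hk
      have : (i : ℕ) ≠ k := fun h => hk (Fin.ext h.symm)
      simp [Fin.ext_iff, this]
    · simp
  · rw [Finset.sum_eq_zero, AddChar.map_zero_eq_one]
    intro k _
    have : ¬ ((i : ℕ) = k ∧ (j : ℕ) = k + 1) := by omega
    simp [Fin.ext_iff, this]

/-- `f` transforms by `ψ` under translations by unitriangular matrices on both sides. -/
def IsBiWhittaker (ψ : AddChar F ℂ) (f : (Matrix (Fin n) (Fin n) F)ˣ → ℂ) : Prop :=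
  ∀ u g v : (Matrix (Fin n) (Fin n) F)ˣ, IsUnipUpper (u : Matrix (Fin n) (Fin n) F) →
    IsUnipUpper (v : Matrix (Fin n) (Fin n) F) →
      f (u * g * v) = psiU ψ (u : Matrix (Fin n) (Fin n) F) *
        psiU ψ (v : Matrix (Fin n) (Fin n) F) * f g

theorem ascent_or_descent_of_monomial {ψ : AddChar F ℂ} (hψ : ψ ≠ 1)
    {f : (Matrix (Fin n) (Fin n) F)ˣ → ℂ} (hf : IsBiWhittaker ψ f)
    {m : (Matrix (Fin n) (Fin n) F)ˣ} (hfm : f m ≠ 0) {w : Fin n → Fin n} {c : Fin n → F}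
    (hw : Function.Injective w) (hc : ∀ j, c j ≠ 0)
    (hm : (m : Matrix (Fin n) (Fin n) F) = Matrix.of fun i j => if i = w j then c j else 0)
    {i j : Fin n} (hij : (i : ℕ) + 1 = j) :
    w j < w i ∨ ((w i : ℕ) + 1 = w j ∧ c j = c i) := by
  classical
  rcases lt_or_ge (w j) (w i) with h | h
  · exact Or.inl h
  right
  have hlt : i < j := by rw [Fin.lt_def]; omega
  have hwlt : w i < w j := lt_of_le_of_ne h fun h' => hlt.ne (hw h')
  have key : ∀ a : F, ψ a = if (w i : ℕ) + 1 = w j then ψ (a * c i / c j) else 1 := by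
    intro a
    obtain ⟨u, hu⟩ := (isUnipUpper_transvection hlt a).exists_unit
    obtain ⟨v, hv⟩ := (isUnipUpper_transvection hwlt (a * c i / c j)).exists_unit
    have hu' : IsUnipUpper (u : Matrix (Fin n) (Fin n) F) := by
      rw [hu]; exact isUnipUpper_transvection hlt a
    have hv' : IsUnipUpper (v : Matrix (Fin n) (Fin n) F) := by
      rw [hv]; exact isUnipUpper_transvection hwlt _
    have hcomm : m * u = v * m := by
      refine Units.ext ?_
      rw [Units.val_mul, Units.val_mul, hu, hv, mul_add, add_mul, mul_one, one_mul]
      congr 1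
      ext k l
      rw [Matrix.mul_apply, Matrix.mul_apply, Finset.sum_eq_single i, Finset.sum_eq_single (w j)]
      · by_cases hl : j = l
        · subst hl
          by_cases hk : w i = k
          · subst hk
            simp only [hm, Matrix.of_apply, if_true, Matrix.single_apply, and_self]
            field_simp [hc j]
          · simp [hm, Ne.symm hk, hk]
        · simp [hm, hw.eq_iff, hl]
      · intro b _ hb
        simp [hb.symm]
      · simp
      · intro b _ hb
        simp [hb.symm]
      · simp
    have h1 := hf 1 m u (by simpa using IsUnipUpper.one) hu'
    have h2 := hf v m 1 hv' (by simpa using IsUnipUpper.one)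
    rw [one_mul, Units.val_one, psiU_one, one_mul] at h1
    rw [mul_one, Units.val_one, psiU_one, mul_one, ← hcomm, h1] at h2
    have h3 := mul_right_cancel₀ hfm h2
    rwa [hu, hv, psiU_transvection, psiU_transvection, if_pos hij] at h3
  obtain ⟨a, ha⟩ := (AddChar.ne_one_iff).1 hψ
  by_cases hstep : (w i : ℕ) + 1 = w j
  · refine ⟨hstep, ?_⟩
    by_contra hne
    simp only [if_pos hstep] at key
    have hd : 1 - c i / c j ≠ 0 := by
      rw [sub_ne_zero, Ne, eq_comm, div_eq_one_iff_eq (hc j)]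
      exact fun h => hne h.symm
    refine ha ?_
    have e : a = a / (1 - c i / c j) + -(a / (1 - c i / c j) * c i / c j) := by
      have := hc j
      have h' : c j - c i ≠ 0 := sub_ne_zero.2 hne
      field_simp
      ring
    rw [e, AddChar.map_add_eq_mul, key, ← AddChar.map_add_eq_mul, add_neg_cancel,
      AddChar.map_zero_eq_one]
  · exact absurd ((key a).trans (if_neg hstep)) ha

theorem unitAntiTranspose_eq_of_monomial {ψ : AddChar F ℂ} (hψ : ψ ≠ 1)
    {f : (Matrix (Fin n) (Fin n) F)ˣ → ℂ} (hf : IsBiWhittaker ψ f)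
    {m : (Matrix (Fin n) (Fin n) F)ˣ} (hfm : f m ≠ 0) {w : Fin n → Fin n} {c : Fin n → F}
    (hw : Function.Injective w) (hc : ∀ j, c j ≠ 0)
    (hm : (m : Matrix (Fin n) (Fin n) F) = Matrix.of fun i j => if i = w j then c j else 0) :
    unitAntiTranspose m = m := by
  have hinv := involutive_of_ascent_or_descent_by_one (φ := fun j => (w j).rev) (c := c)
    (Fin.rev_injective.comp hw) (fun i j hij => by
      rcases ascent_or_descent_of_monomial hψ hf hfm hw hc hm hij with h | ⟨h, h'⟩
      · exact Or.inl (Fin.rev_lt_rev.2 h)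
      · refine Or.inr ⟨?_, h'⟩
        have := (w j).isLt
        simp only [Fin.val_rev]
        omega)
  have hiff : ∀ i j, i = w j → j.rev = w i.rev ∧ c i.rev = c j := by
    rintro i j rfl
    obtain ⟨h1, h2⟩ := hinv j
    exact ⟨by
      have := congrArg Fin.rev h1
      simpa using this.symm, h2⟩
  refine Units.ext ?_
  change antiTranspose (m : Matrix (Fin n) (Fin n) F) = m
  ext i j
  rw [antiTranspose_apply, hm, Matrix.of_apply, Matrix.of_apply]
  by_cases h : i = w j
  · obtain ⟨h1, h2⟩ := hiff i j h
    rw [if_pos h, if_pos h1, h2]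
  · rw [if_neg h, if_neg]
    intro h'
    have := (hiff _ _ h').1
    rw [Fin.rev_rev, Fin.rev_rev] at this
    exact h this

/-- Gelfand's trick: bi-Whittaker functions are invariant under transposition along the
antidiagonal. -/
theorem IsBiWhittaker.apply_unitAntiTranspose {ψ : AddChar F ℂ} (hψ : ψ ≠ 1)
    {f : (Matrix (Fin n) (Fin n) F)ˣ → ℂ} (hf : IsBiWhittaker ψ f)
    (g : (Matrix (Fin n) (Fin n) F)ˣ) : f (unitAntiTranspose g) = f g := by
  obtain ⟨u, m, v, hu, hv, rfl, w, c, hw, hc, hm⟩ := exists_bruhat g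
  rw [unitAntiTranspose_mul, unitAntiTranspose_mul, ← mul_assoc,
    hf _ _ _ hv.antiTranspose hu.antiTranspose, hf _ _ _ hu hv]
  have e : ∀ x : (Matrix (Fin n) (Fin n) F)ˣ, psiU ψ
      (unitAntiTranspose x : Matrix (Fin n) (Fin n) F) =
        psiU ψ (x : Matrix (Fin n) (Fin n) F) := fun x => psiU_antiTranspose ψ _
  rw [e, e, mul_comm (psiU ψ (v : Matrix (Fin n) (Fin n) F))]
  congr 1
  by_cases hfm : f m = 0
  · by_cases hfm' : f (unitAntiTranspose m) = 0
    · rw [hfm, hfm']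
    · have hf' : IsBiWhittaker ψ fun x => f (unitAntiTranspose x) := by
        intro a x b ha hb
        beta_reduce
        rw [unitAntiTranspose_mul, unitAntiTranspose_mul, ← mul_assoc,
          hf _ _ _ hb.antiTranspose ha.antiTranspose, e, e, mul_comm (psiU ψ _)]
      rw [unitAntiTranspose_eq_of_monomial hψ hf' hfm' hw hc hm]
  · rw [unitAntiTranspose_eq_of_monomial hψ hf hfm hw hc hm]

end Gelfand

section Schur

variable {F : Type} [Field F] {n : ℕ}

/-- The matrices of the representation `π`, as a monoid homomorphism. -/
def FinRep.mat (π : FinRep n F) :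
    (Matrix (Fin n) (Fin n) F)ˣ →* Matrix (Fin π.d) (Fin π.d) ℂ :=
  (Units.coeHom _).comp π.ρ

theorem FinRep.coe_ρ (π : FinRep n F) (g : (Matrix (Fin n) (Fin n) F)ˣ) :
    (π.ρ g : Matrix (Fin π.d) (Fin π.d) ℂ) = π.mat g := rfl

theorem FinRep.mat_mul_mat_inv (π : FinRep n F) (g : (Matrix (Fin n) (Fin n) F)ˣ) :
    π.mat g * π.mat g⁻¹ = 1 := by
  rw [← map_mul, mul_inv_cancel, map_one]

theorem FinRep.mat_inv_mul_mat (π : FinRep n F) (g : (Matrix (Fin n) (Fin n) F)ˣ) :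
    π.mat g⁻¹ * π.mat g = 1 := by
  rw [← map_mul, inv_mul_cancel, map_one]

/-- Schur's lemma: a nonzero intertwiner between irreducible representations is bijective. -/
theorem FinRep.Irreducible.bijective_of_intertwines {σ τ : FinRep n F} (hσ : σ.Irreducible)
    (hτ : τ.Irreducible) {A : Matrix (Fin σ.d) (Fin τ.d) ℂ} (hA : A ≠ 0)
    (h : ∀ g, σ.mat g * A = A * τ.mat g) : Function.Bijective A.mulVecLin := by
  have hne : A.mulVecLin ≠ 0 := by
    intro h0
    refine hA (Matrix.ext_of_mulVec_single fun i => ?_)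
    rw [← Matrix.mulVecLin_apply, h0, Matrix.zero_mulVec, LinearMap.zero_apply]
  have hcomm : ∀ g v, A.mulVec ((τ.mat g).mulVec v) = (σ.mat g).mulVec (A.mulVec v) := by
    intro g v
    rw [Matrix.mulVec_mulVec, Matrix.mulVec_mulVec, h]
  constructor
  · rw [← LinearMap.ker_eq_bot]
    refine (hτ.2 (LinearMap.ker A.mulVecLin) fun g v hv => ?_).resolve_right fun h0 =>
      hne (LinearMap.ker_eq_top.1 h0)
    rw [LinearMap.mem_ker, Matrix.mulVecLin_apply] at hv ⊢
    rw [FinRep.coe_ρ, hcomm, hv, Matrix.mulVec_zero]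
  · rw [← LinearMap.range_eq_top]
    refine (hσ.2 (LinearMap.range A.mulVecLin) fun g v hv => ?_).resolve_left fun h0 =>
      hne (LinearMap.range_eq_bot.1 h0)
    obtain ⟨x, rfl⟩ := hv
    exact ⟨(τ.mat g).mulVec x, hcomm g x⟩

theorem FinRep.iso_of_intertwines {σ τ : FinRep n F} (hσ : σ.Irreducible)
    (hτ : τ.Irreducible) {A : Matrix (Fin σ.d) (Fin τ.d) ℂ} (hA : A ≠ 0)
    (h : ∀ g, σ.mat g * A = A * τ.mat g) : τ.Iso σ := by
  refine ⟨LinearEquiv.ofBijective _ (hσ.bijective_of_intertwines hτ hA h), fun g v => ?_⟩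
  simp only [LinearEquiv.ofBijective_apply, Matrix.mulVecLin_apply, FinRep.coe_ρ]
  rw [Matrix.mulVec_mulVec, Matrix.mulVec_mulVec, h]

theorem FinRep.Irreducible.eq_smul_one {σ : FinRep n F} (hσ : σ.Irreducible)
    {A : Matrix (Fin σ.d) (Fin σ.d) ℂ} (h : ∀ g, σ.mat g * A = A * σ.mat g) :
    ∃ a : ℂ, A = a • (1 : Matrix (Fin σ.d) (Fin σ.d) ℂ) := by
  have : Nonempty (Fin σ.d) := ⟨⟨0, hσ.1⟩⟩
  obtain ⟨a, ha⟩ := Module.End.exists_eigenvalue A.mulVecLin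
  refine ⟨a, ?_⟩
  by_contra hne
  obtain ⟨v, hv⟩ := ha.exists_hasEigenvector
  have hinj := (hσ.bijective_of_intertwines hσ (sub_ne_zero.2 hne) fun g => by
    rw [mul_sub, sub_mul, h]; simp).1
  refine hv.2 (hinj ?_)
  have := hv.apply_eq_smul
  rw [Matrix.mulVecLin_apply] at this
  simp [this]

variable [Fintype F] [DecidableEq F]

theorem FinRep.intertwines_sum (σ τ : FinRep n F) (X : Matrix (Fin σ.d) (Fin τ.d) ℂ)
    (g : (Matrix (Fin n) (Fin n) F)ˣ) :
    σ.mat g * (∑ h, σ.mat h * X * τ.mat h⁻¹) = (∑ h, σ.mat h * X * τ.mat h⁻¹) * τ.mat g := by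
  rw [Matrix.mul_sum, Matrix.sum_mul, ← Equiv.sum_comp (Equiv.mulLeft g)
    (fun h => σ.mat h * X * τ.mat h⁻¹ * τ.mat g)]
  refine Finset.sum_congr rfl fun h _ => ?_
  rw [Equiv.coe_mulLeft, mul_inv_rev, map_mul, map_mul]
  simp only [Matrix.mul_assoc]
  rw [τ.mat_inv_mul_mat, Matrix.mul_one]

theorem FinRep.sum_mul_mul_inv_of_not_iso {σ τ : FinRep n F} (hσ : σ.Irreducible)
    (hτ : τ.Irreducible) (hne : ¬ τ.Iso σ) (X : Matrix (Fin σ.d) (Fin τ.d) ℂ) :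
    ∑ h, σ.mat h * X * τ.mat h⁻¹ = 0 := by
  by_contra h
  exact hne (FinRep.iso_of_intertwines hσ hτ h (σ.intertwines_sum τ X))

theorem FinRep.Irreducible.sum_mul_mul_inv {σ : FinRep n F} (hσ : σ.Irreducible)
    (X : Matrix (Fin σ.d) (Fin σ.d) ℂ) :
    ∑ h, σ.mat h * X * σ.mat h⁻¹ =
      ((Fintype.card (Matrix (Fin n) (Fin n) F)ˣ : ℂ) / σ.d * X.trace) •
        (1 : Matrix (Fin σ.d) (Fin σ.d) ℂ) := by
  obtain ⟨a, ha⟩ := hσ.eq_smul_one (σ.intertwines_sum σ X)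
  have htr := congrArg Matrix.trace ha
  have hterm : ∀ h, (σ.mat h * X * σ.mat h⁻¹).trace = X.trace := by
    intro h
    rw [Matrix.trace_mul_cycle, σ.mat_inv_mul_mat, Matrix.one_mul]
  rw [Matrix.trace_sum, Finset.sum_congr rfl fun h _ => hterm h] at htr
  simp only [Finset.sum_const, Finset.card_univ, nsmul_eq_mul, Matrix.trace_smul,
    Matrix.trace_one, Fintype.card_fin, smul_eq_mul] at htr
  have hd : (σ.d : ℂ) ≠ 0 := Nat.cast_ne_zero.2 hσ.1.ne'
  rw [ha]
  congr 1
  field_simp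
  exact htr.symm

theorem FinRep.sum_diag_mul_diag (σ τ : FinRep n F) (P : Matrix (Fin σ.d) (Fin σ.d) ℂ)
    (Q : Matrix (Fin τ.d) (Fin τ.d) ℂ) (i : Fin σ.d) (j : Fin τ.d)
    {X : Matrix (Fin σ.d) (Fin τ.d) ℂ} (hX : X = P * Matrix.single i j (1 : ℂ)) :
    ∑ h, (σ.mat h * P) i i * (τ.mat h⁻¹ * Q) j j =
      ((∑ h, σ.mat h * X * τ.mat h⁻¹) * Q) i j := by
  rw [Matrix.sum_mul, Matrix.sum_apply]
  refine Finset.sum_congr rfl fun h _ => ?_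
  symm
  rw [hX, Matrix.mul_assoc, ← Matrix.mul_assoc (σ.mat h), Matrix.mul_apply,
    Finset.sum_eq_single j]
  · simp
  · intro b _ hb
    simp [hb]
  · simp

theorem FinRep.sum_trace_mul_trace (σ τ : FinRep n F) (P : Matrix (Fin σ.d) (Fin σ.d) ℂ)
    (Q : Matrix (Fin τ.d) (Fin τ.d) ℂ) :
    ∑ h, (σ.mat h * P).trace * (τ.mat h⁻¹ * Q).trace =
      ∑ i, ∑ j, ∑ h, (σ.mat h * P) i i * (τ.mat h⁻¹ * Q) j j := by
  simp_rw [Matrix.trace, Matrix.diag, Finset.sum_mul_sum]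
  rw [Finset.sum_comm]
  exact Finset.sum_congr rfl fun i _ => Finset.sum_comm

/-- Schur orthogonality for non-isomorphic representations. -/
theorem FinRep.sum_trace_mul_trace_of_not_iso {σ τ : FinRep n F} (hσ : σ.Irreducible)
    (hτ : τ.Irreducible) (hne : ¬ τ.Iso σ) (P : Matrix (Fin σ.d) (Fin σ.d) ℂ)
    (Q : Matrix (Fin τ.d) (Fin τ.d) ℂ) :
    ∑ h, (σ.mat h * P).trace * (τ.mat h⁻¹ * Q).trace = 0 := by
  rw [FinRep.sum_trace_mul_trace]
  refine Finset.sum_eq_zero fun i _ => Finset.sum_eq_zero fun j _ => ?_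
  rw [FinRep.sum_diag_mul_diag σ τ P Q i j rfl,
    FinRep.sum_mul_mul_inv_of_not_iso hσ hτ hne, Matrix.zero_mul, Matrix.zero_apply]

/-- Schur orthogonality for a single representation. -/
theorem FinRep.Irreducible.sum_trace_mul_trace {σ : FinRep n F} (hσ : σ.Irreducible)
    (P Q : Matrix (Fin σ.d) (Fin σ.d) ℂ) :
    ∑ h, (σ.mat h * P).trace * (σ.mat h⁻¹ * Q).trace =
      (Fintype.card (Matrix (Fin n) (Fin n) F)ˣ : ℂ) / σ.d * (P * Q).trace := by
  rw [FinRep.sum_trace_mul_trace, Finset.sum_comm]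
  simp_rw [fun i j => FinRep.sum_diag_mul_diag σ σ P Q i j rfl, hσ.sum_mul_mul_inv,
    Matrix.smul_mul, Matrix.one_mul, Matrix.smul_apply, Matrix.trace_mul_single]
  simp [Matrix.trace, Matrix.mul_apply, Finset.mul_sum, mul_assoc]

/-- Burnside's theorem: the matrices of an irreducible representation span all matrices. -/
theorem FinRep.Irreducible.eq_sum_smul {σ : FinRep n F} (hσ : σ.Irreducible)
    (A : Matrix (Fin σ.d) (Fin σ.d) ℂ) :
    ∃ c : (Matrix (Fin n) (Fin n) F)ˣ → ℂ, A = ∑ h, c h • σ.mat h := by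
  have hd : (σ.d : ℂ) ≠ 0 := Nat.cast_ne_zero.2 hσ.1.ne'
  have hG : (Fintype.card (Matrix (Fin n) (Fin n) F)ˣ : ℂ) ≠ 0 :=
    Nat.cast_ne_zero.2 Fintype.card_ne_zero
  refine ⟨fun h => (σ.d / Fintype.card (Matrix (Fin n) (Fin n) F)ˣ : ℂ) *
    (σ.mat h⁻¹ * A).trace, ?_⟩
  ext i j
  have := hσ.sum_trace_mul_trace (Matrix.single j i 1) A
  simp only [Matrix.trace_mul_single, Matrix.trace_single_mul, MulOpposite.op_one, one_smul] at this
  simp only [Matrix.sum_apply, Matrix.smul_apply, smul_eq_mul, mul_assoc, ← Finset.mul_sum]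
  simp_rw [mul_comm _ (σ.mat _ i j)]
  rw [this]
  field_simp

open scoped ComplexOrder in
/-- The character of a representation of a finite group is unitary. -/
theorem FinRep.conj_trace_mat (σ : FinRep n F) (g : (Matrix (Fin n) (Fin n) F)ˣ) :
    (starRingEnd ℂ) (σ.mat g).trace = (σ.mat g⁻¹).trace := by
  set P : Matrix (Fin σ.d) (Fin σ.d) ℂ := ∑ h, (σ.mat h).conjTranspose * σ.mat h with hP
  have hpos : P.PosDef := by
    refine Matrix.posDef_sum Finset.univ_nonempty fun h _ =>
      Matrix.PosDef.conjTranspose_mul_self _ ?_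
    refine Function.LeftInverse.injective (g := (σ.mat h⁻¹).mulVec) fun v => ?_
    rw [Matrix.mulVec_mulVec, σ.mat_inv_mul_mat, Matrix.one_mulVec]
  have hinv : (σ.mat g).conjTranspose * P * σ.mat g = P := by
    rw [hP, Finset.mul_sum, Finset.sum_mul, ← Equiv.sum_comp (Equiv.mulRight g)
      (fun h => (σ.mat h).conjTranspose * σ.mat h)]
    refine Finset.sum_congr rfl fun h _ => ?_
    rw [Equiv.coe_mulRight, map_mul, Matrix.conjTranspose_mul]
    simp only [Matrix.mul_assoc]
  have hunit : P * P⁻¹ = 1 :=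
    Matrix.mul_nonsing_inv _ ((Matrix.isUnit_iff_isUnit_det P).1 hpos.isUnit)
  have h1 : (σ.mat g).conjTranspose = P * σ.mat g⁻¹ * P⁻¹ := by
    nth_rewrite 1 [← hinv]
    rw [Matrix.mul_assoc _ (σ.mat g), σ.mat_mul_mat_inv, Matrix.mul_one, Matrix.mul_assoc, hunit,
      Matrix.mul_one]
  have h2 := Matrix.trace_conjTranspose (σ.mat g)
  rw [h1, Matrix.trace_mul_cycle,
    Matrix.nonsing_inv_mul _ ((Matrix.isUnit_iff_isUnit_det P).1 hpos.isUnit),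
    Matrix.one_mul] at h2
  exact h2.symm

end Schur

section Whittaker

variable {F : Type} [Field F] [Fintype F] [DecidableEq F] {n : ℕ}

variable (F n) in
open scoped Classical in
/-- The set of upper unitriangular elements of the general linear group. -/
noncomputable def unipUnits : Finset (Matrix (Fin n) (Fin n) F)ˣ :=
  Finset.univ.filter fun u => IsUnipUpper (u : Matrix (Fin n) (Fin n) F)

theorem mem_unipUnits {u : (Matrix (Fin n) (Fin n) F)ˣ} :
    u ∈ unipUnits F n ↔ IsUnipUpper (u : Matrix (Fin n) (Fin n) F) := by
  simp [unipUnits]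

theorem sum_unipFinset {M : Type*} [AddCommMonoid M] (h : Matrix (Fin n) (Fin n) F → M) :
    ∑ u ∈ unipFinset F n, h u = ∑ u ∈ unipUnits F n, h (u : Matrix (Fin n) (Fin n) F) := by
  symm
  refine Finset.sum_nbij (fun u => (u : Matrix (Fin n) (Fin n) F)) ?_ ?_ ?_ fun _ _ => rfl
  · intro u hu
    simpa [unipFinset] using mem_unipUnits.1 hu
  · exact Units.val_injective.injOn
  · intro u hu
    have hu' : IsUnipUpper u := by simpa [unipFinset] using hu
    obtain ⟨v, rfl⟩ := hu'.exists_unit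
    exact ⟨v, mem_unipUnits.2 hu', rfl⟩

omit [DecidableEq F] in
theorem card_unipFinset_ne_zero : ((unipFinset F n).card : ℂ) ≠ 0 := by
  refine Nat.cast_ne_zero.2 (Finset.card_ne_zero_of_mem (a := 1) ?_)
  simpa [unipFinset] using IsUnipUpper.one

theorem sum_unipUnits_mul_right {M : Type*} [AddCommMonoid M]
    (f : (Matrix (Fin n) (Fin n) F)ˣ → M) {v : (Matrix (Fin n) (Fin n) F)ˣ}
    (hv : IsUnipUpper (v : Matrix (Fin n) (Fin n) F)) :
    ∑ u ∈ unipUnits F n, f (u * v) = ∑ u ∈ unipUnits F n, f u := by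
  refine Finset.sum_equiv (Equiv.mulRight v) (fun u => ?_) fun _ _ => rfl
  rw [Equiv.coe_mulRight, mem_unipUnits, mem_unipUnits]
  refine ⟨fun h => h.mul hv, fun h => ?_⟩
  have := h.mul hv.inv
  rwa [← Units.val_mul, mul_inv_cancel_right] at this

theorem sum_unipUnits_mul_left {M : Type*} [AddCommMonoid M]
    (f : (Matrix (Fin n) (Fin n) F)ˣ → M) {v : (Matrix (Fin n) (Fin n) F)ˣ}
    (hv : IsUnipUpper (v : Matrix (Fin n) (Fin n) F)) :
    ∑ u ∈ unipUnits F n, f (v * u) = ∑ u ∈ unipUnits F n, f u := by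
  refine Finset.sum_equiv (Equiv.mulLeft v) (fun u => ?_) fun _ _ => rfl
  rw [Equiv.coe_mulLeft, mem_unipUnits, mem_unipUnits]
  refine ⟨fun h => hv.mul h, fun h => ?_⟩
  have := hv.inv.mul h
  rwa [← Units.val_mul, inv_mul_cancel_left] at this

theorem sum_unipUnits_inv {M : Type*} [AddCommMonoid M]
    (f : (Matrix (Fin n) (Fin n) F)ˣ → M) :
    ∑ u ∈ unipUnits F n, f u⁻¹ = ∑ u ∈ unipUnits F n, f u := by
  refine Finset.sum_equiv (Equiv.inv _) (fun u => ?_) fun _ _ => rfl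
  rw [Equiv.inv_apply, mem_unipUnits, mem_unipUnits]
  exact ⟨fun h => h.inv, fun h => by simpa using h.inv⟩

theorem sum_unipUnits_unitAntiTranspose {M : Type*} [AddCommMonoid M]
    (f : (Matrix (Fin n) (Fin n) F)ˣ → M) :
    ∑ u ∈ unipUnits F n, f (unitAntiTranspose u) = ∑ u ∈ unipUnits F n, f u := by
  refine Finset.sum_equiv ⟨unitAntiTranspose, unitAntiTranspose,
    unitAntiTranspose_unitAntiTranspose, unitAntiTranspose_unitAntiTranspose⟩
    (fun u => ?_) fun _ _ => rfl
  rw [Equiv.coe_fn_mk, mem_unipUnits, mem_unipUnits]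
  refine ⟨fun h => h.antiTranspose, fun h => ?_⟩
  rw [← unitAntiTranspose_unitAntiTranspose u]
  exact h.antiTranspose

/-- The projector of a representation onto its space of `ψ`-Whittaker vectors. -/
noncomputable def FinRep.whittakerProj (ψ : AddChar F ℂ) (π : FinRep n F) :
    Matrix (Fin π.d) (Fin π.d) ℂ :=
  ((unipFinset F n).card : ℂ)⁻¹ •
    ∑ u ∈ unipUnits F n, (psiU ψ (u : Matrix (Fin n) (Fin n) F))⁻¹ • π.mat u

variable {ψ : AddChar F ℂ} {π : FinRep n F}

theorem FinRep.whittakerProj_mul_mat {v : (Matrix (Fin n) (Fin n) F)ˣ}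
    (hv : IsUnipUpper (v : Matrix (Fin n) (Fin n) F)) :
    π.whittakerProj ψ * π.mat v =
      psiU ψ (v : Matrix (Fin n) (Fin n) F) • π.whittakerProj ψ := by
  rw [FinRep.whittakerProj, smul_mul_assoc, smul_comm, Finset.sum_mul,
    ← sum_unipUnits_mul_right (fun u => (psiU ψ (u : Matrix (Fin n) (Fin n) F))⁻¹ • π.mat u) hv]
  congr 1
  rw [Finset.smul_sum]
  refine Finset.sum_congr rfl fun u hu => ?_
  rw [smul_mul_assoc, ← map_mul, smul_smul, Units.val_mul, psiU_mul ψ (mem_unipUnits.1 hu) hv,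
    mul_inv_rev, mul_inv_cancel_left₀ (psiU_ne_zero ψ _)]

theorem FinRep.mat_mul_whittakerProj {v : (Matrix (Fin n) (Fin n) F)ˣ}
    (hv : IsUnipUpper (v : Matrix (Fin n) (Fin n) F)) :
    π.mat v * π.whittakerProj ψ =
      psiU ψ (v : Matrix (Fin n) (Fin n) F) • π.whittakerProj ψ := by
  rw [FinRep.whittakerProj, mul_smul_comm, smul_comm, Finset.mul_sum,
    ← sum_unipUnits_mul_left (fun u => (psiU ψ (u : Matrix (Fin n) (Fin n) F))⁻¹ • π.mat u) hv]
  congr 1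
  rw [Finset.smul_sum]
  refine Finset.sum_congr rfl fun u hu => ?_
  rw [mul_smul_comm, ← map_mul, smul_smul, Units.val_mul, psiU_mul ψ hv (mem_unipUnits.1 hu),
    mul_inv, mul_inv_cancel_left₀ (psiU_ne_zero ψ _)]

theorem card_unipUnits : (unipUnits F n).card = (unipFinset F n).card := by
  have := sum_unipFinset (F := F) (n := n) fun _ => 1
  simpa using this.symm

theorem FinRep.whittakerProj_mul_self :
    π.whittakerProj ψ * π.whittakerProj ψ = π.whittakerProj ψ := by
  conv_lhs =>
    lhs
    rw [FinRep.whittakerProj]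
  rw [smul_mul_assoc, Finset.sum_mul]
  have : ∀ u ∈ unipUnits F n, (psiU ψ (u : Matrix (Fin n) (Fin n) F))⁻¹ • π.mat u *
      π.whittakerProj ψ = π.whittakerProj ψ := by
    intro u hu
    rw [smul_mul_assoc, FinRep.mat_mul_whittakerProj (mem_unipUnits.1 hu),
      inv_smul_smul₀ (psiU_ne_zero ψ _)]
  rw [Finset.sum_congr rfl this, Finset.sum_const, card_unipUnits, ← Nat.cast_smul_eq_nsmul ℂ,
    inv_smul_smul₀ card_unipFinset_ne_zero]

theorem FinRep.Generic.whittakerProj_ne_zero (h : π.Generic ψ) : π.whittakerProj ψ ≠ 0 := by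
  obtain ⟨ℓ, hℓ, hu⟩ := h
  obtain ⟨v, hv⟩ : ∃ v, ℓ v ≠ 0 := by
    by_contra! h
    exact hℓ (LinearMap.ext h)
  intro h0
  refine hv ?_
  have h1 : ℓ ((π.whittakerProj ψ).mulVec v) = ℓ v := by
    rw [FinRep.whittakerProj, Matrix.smul_mulVec, Matrix.sum_mulVec, map_smul, map_sum]
    have : ∀ u ∈ unipUnits F n, ℓ (((psiU ψ (u : Matrix (Fin n) (Fin n) F))⁻¹ •
        π.mat u).mulVec v) = ℓ v := by
      intro u hu'
      rw [Matrix.smul_mulVec, map_smul, ← FinRep.coe_ρ, hu u (mem_unipUnits.1 hu'), smul_eq_mul,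
        inv_mul_cancel_left₀ (psiU_ne_zero ψ _)]
    rw [Finset.sum_congr rfl this, Finset.sum_const, card_unipUnits,
      ← Nat.cast_smul_eq_nsmul ℂ, inv_smul_smul₀ card_unipFinset_ne_zero]
  rw [← h1, h0, Matrix.zero_mulVec, map_zero]

theorem FinRep.generic_of_whittakerProj_ne_zero (h : π.whittakerProj ψ ≠ 0) :
    π.Generic ψ := by
  obtain ⟨i, hi⟩ : ∃ i, π.whittakerProj ψ i ≠ 0 := by
    by_contra! h'
    exact h (funext h')
  refine ⟨(LinearMap.proj i).comp (π.whittakerProj ψ).mulVecLin, ?_, ?_⟩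
  · intro h0
    refine hi (funext fun j => ?_)
    have := LinearMap.congr_fun h0 (Pi.single j 1)
    simpa using this
  · intro u hu v
    rw [FinRep.coe_ρ, LinearMap.comp_apply, Matrix.mulVecLin_apply, Matrix.mulVec_mulVec,
      FinRep.whittakerProj_mul_mat hu, Matrix.smul_mulVec]
    simp

omit [Fintype F] [DecidableEq F] in
theorem traceChar_coe (g : (Matrix (Fin n) (Fin n) F)ˣ) :
    traceChar π (g : Matrix (Fin n) (Fin n) F) = (π.mat g).trace := by
  rw [traceChar, dif_pos g.isUnit, IsUnit.unit_of_val_units, FinRep.coe_ρ]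

theorem Bessel_coe (g : (Matrix (Fin n) (Fin n) F)ˣ) :
    Bessel ψ π (g : Matrix (Fin n) (Fin n) F) = (π.mat g * π.whittakerProj ψ).trace := by
  rw [Bessel, sum_unipFinset, FinRep.whittakerProj, mul_smul_comm, Matrix.mul_sum,
    Matrix.trace_smul, Matrix.trace_sum, smul_eq_mul]
  congr 1
  refine Finset.sum_congr rfl fun u _ => ?_
  rw [← Units.val_mul, traceChar_coe, map_mul, mul_smul_comm, Matrix.trace_smul, smul_eq_mul]

omit [DecidableEq F] in
theorem conj_psiU (u : Matrix (Fin n) (Fin n) F) :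
    (starRingEnd ℂ) (psiU ψ u) = (psiU ψ u)⁻¹ := by
  rw [psiU, ← AddChar.map_neg_eq_conj, AddChar.map_neg_eq_inv]

theorem conj_Bessel_coe (g : (Matrix (Fin n) (Fin n) F)ˣ) :
    (starRingEnd ℂ) (Bessel ψ π (g : Matrix (Fin n) (Fin n) F)) =
      (π.mat g⁻¹ * π.whittakerProj ψ).trace := by
  rw [← Bessel_coe, Bessel, Bessel, sum_unipFinset, sum_unipFinset, map_mul, map_sum, map_inv₀,
    map_natCast, ← sum_unipUnits_inv]
  congr 1
  refine Finset.sum_congr rfl fun u hu => ?_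
  rw [map_mul, map_inv₀, conj_psiU, ← Units.val_mul, ← Units.val_mul, traceChar_coe,
    traceChar_coe, FinRep.conj_trace_mat, psiU_inv ψ (mem_unipUnits.1 hu), inv_inv, mul_inv_rev,
    map_mul, map_mul, Matrix.trace_mul_comm, inv_inv]

theorem FinRep.isBiWhittaker_whittakerProj (i j : Fin π.d) :
    IsBiWhittaker ψ fun g => (π.whittakerProj ψ * π.mat g * π.whittakerProj ψ) i j := by
  intro u g v hu hv
  have : π.whittakerProj ψ * π.mat (u * g * v) * π.whittakerProj ψ =
      (psiU ψ (u : Matrix (Fin n) (Fin n) F) * psiU ψ (v : Matrix (Fin n) (Fin n) F)) •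
        (π.whittakerProj ψ * π.mat g * π.whittakerProj ψ) := by
    rw [map_mul, map_mul, ← mul_assoc, ← mul_assoc, whittakerProj_mul_mat hu, mul_assoc _ (π.mat v),
      mat_mul_whittakerProj hv, smul_mul_assoc, smul_mul_assoc, mul_smul_comm, smul_smul]
  beta_reduce
  rw [this, Matrix.smul_apply, smul_eq_mul]

theorem FinRep.whittakerProj_mul_mat_comm (hψ : ψ ≠ 1) (x y : (Matrix (Fin n) (Fin n) F)ˣ) :
    π.whittakerProj ψ * π.mat x * π.whittakerProj ψ * π.mat y * π.whittakerProj ψ =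
      π.whittakerProj ψ * π.mat y * π.whittakerProj ψ * π.mat x * π.whittakerProj ψ := by
  have key : ∀ x y, π.whittakerProj ψ * π.mat x * π.whittakerProj ψ * π.mat y *
      π.whittakerProj ψ = ((unipFinset F n).card : ℂ)⁻¹ • ∑ u ∈ unipUnits F n,
        (psiU ψ (u : Matrix (Fin n) (Fin n) F))⁻¹ •
          (π.whittakerProj ψ * π.mat (x * u * y) * π.whittakerProj ψ) := by
    intro x y
    conv_lhs =>
      lhs
      lhs
      rhs
      rw [FinRep.whittakerProj]
    simp only [mul_smul_comm, smul_mul_assoc, Finset.mul_sum, Finset.sum_mul, map_mul, mul_assoc]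
  have hτ : ∀ g, π.whittakerProj ψ * π.mat (unitAntiTranspose g) * π.whittakerProj ψ =
      π.whittakerProj ψ * π.mat g * π.whittakerProj ψ := by
    intro g
    ext i j
    exact (isBiWhittaker_whittakerProj i j).apply_unitAntiTranspose hψ g
  calc _ = _ := key x y
    _ = ((unipFinset F n).card : ℂ)⁻¹ • ∑ u ∈ unipUnits F n,
        (psiU ψ (u : Matrix (Fin n) (Fin n) F))⁻¹ •
          (π.whittakerProj ψ * π.mat (unitAntiTranspose y * u * unitAntiTranspose x) *
            π.whittakerProj ψ) := by
      rw [← sum_unipUnits_unitAntiTranspose]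
      congr 1
      refine Finset.sum_congr rfl fun u _ => ?_
      have e : psiU ψ (unitAntiTranspose u : Matrix (Fin n) (Fin n) F) =
        psiU ψ (u : Matrix (Fin n) (Fin n) F) := psiU_antiTranspose ψ _
      rw [e, ← hτ (x * unitAntiTranspose u * y), unitAntiTranspose_mul, unitAntiTranspose_mul,
        unitAntiTranspose_unitAntiTranspose, mul_assoc (unitAntiTranspose y)]
    _ = _ := by
      rw [← key, hτ, mul_assoc, mul_assoc, ← mul_assoc (π.whittakerProj ψ)
        (π.mat (unitAntiTranspose x)), hτ]
      simp only [mul_assoc]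

end Whittaker

section Fourier

variable {F : Type} [Field F] [Fintype F] [DecidableEq F] {n : ℕ}

theorem FinRep.Irreducible.whittakerProj_mul_comm {ψ : AddChar F ℂ} (hψ : ψ ≠ 1)
    {σ : FinRep n F} (hσ : σ.Irreducible) (A B : Matrix (Fin σ.d) (Fin σ.d) ℂ) :
    σ.whittakerProj ψ * A * σ.whittakerProj ψ * B * σ.whittakerProj ψ =
      σ.whittakerProj ψ * B * σ.whittakerProj ψ * A * σ.whittakerProj ψ := by
  obtain ⟨a, rfl⟩ := hσ.eq_sum_smul A
  obtain ⟨b, rfl⟩ := hσ.eq_sum_smul B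
  simp only [Finset.mul_sum, Finset.sum_mul, mul_smul_comm, smul_mul_assoc, Finset.smul_sum]
  rw [Finset.sum_comm]
  refine Finset.sum_congr rfl fun x _ => Finset.sum_congr rfl fun y _ => ?_
  rw [FinRep.whittakerProj_mul_mat_comm hψ, smul_comm]

theorem FinRep.Irreducible.trace_smul_whittakerProj_mul {ψ : AddChar F ℂ} (hψ : ψ ≠ 1)
    {σ : FinRep n F} (hσ : σ.Irreducible) (X : Matrix (Fin σ.d) (Fin σ.d) ℂ) :
    (σ.whittakerProj ψ).trace • (σ.whittakerProj ψ * X * σ.whittakerProj ψ) =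
      (X * σ.whittakerProj ψ).trace • σ.whittakerProj ψ := by
  set e := σ.whittakerProj ψ
  have hX : (X * e).trace = (e * X * e).trace := by
    rw [Matrix.trace_mul_comm (e * X), ← mul_assoc, FinRep.whittakerProj_mul_self,
      Matrix.trace_mul_comm]
  have h : ∀ p i j q, e p i * (e * X * e) j q = (e * X * e) p i * e j q := by
    intro p i j q
    have := congrFun (congrFun (hσ.whittakerProj_mul_comm hψ (Matrix.single i j 1) X) p) q
    change (e * (Matrix.single i j 1 : Matrix _ _ ℂ) * e * X * e : Matrix _ _ ℂ) p q =
      (e * X * e * (Matrix.single i j 1 : Matrix _ _ ℂ) * e : Matrix _ _ ℂ) p q at this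
    have hs : ∀ (P Q : Matrix (Fin σ.d) (Fin σ.d) ℂ),
        (P * (Matrix.single i j 1 : Matrix _ _ ℂ) * Q : Matrix _ _ ℂ) p q = P p i * Q j q := by
      intro P Q
      rw [Matrix.mul_apply, Finset.sum_eq_single j]
      · simp
      · intro k _ hk
        rw [Matrix.mul_single_apply_of_ne _ _ _ _ _ hk, zero_mul]
      · simp
    rw [mul_assoc (e * Matrix.single i j 1) e X, mul_assoc (e * Matrix.single i j 1), hs, hs]
      at this
    exact this
  rw [hX]
  ext p i
  simp only [Matrix.smul_apply, Matrix.trace, Matrix.diag, smul_eq_mul, Finset.sum_mul]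
  exact Finset.sum_congr rfl fun j _ => by rw [mul_comm, ← h, mul_comm]

theorem FinRep.Irreducible.trace_whittakerProj {ψ : AddChar F ℂ} (hψ : ψ ≠ 1)
    {σ : FinRep n F} (hσ : σ.Irreducible) (he : σ.whittakerProj ψ ≠ 0) :
    (σ.whittakerProj ψ).trace = 1 := by
  obtain ⟨p, i, hpi⟩ : ∃ p i, σ.whittakerProj ψ p i ≠ 0 := by
    by_contra! h
    exact he (Matrix.ext h)
  have := congrFun (congrFun (hσ.trace_smul_whittakerProj_mul hψ (Matrix.single i p 1)) p) i
  rw [Matrix.smul_apply, Matrix.smul_apply, Matrix.trace_single_mul, Matrix.mul_apply,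
    Finset.sum_eq_single p] at this
  · simp only [Matrix.mul_single_apply_same, mul_one, smul_eq_mul] at this
    exact mul_right_cancel₀ (mul_ne_zero hpi hpi) (by simpa using this)
  · intro k _ hk
    rw [Matrix.mul_single_apply_of_ne _ _ _ _ _ hk, zero_mul]
  · simp

/-- The Whittaker projector of an irreducible representation has rank at most one. -/
theorem FinRep.Irreducible.whittakerProj_mul_mul {ψ : AddChar F ℂ} (hψ : ψ ≠ 1)
    {σ : FinRep n F} (hσ : σ.Irreducible) (X : Matrix (Fin σ.d) (Fin σ.d) ℂ) :
    σ.whittakerProj ψ * X * σ.whittakerProj ψ =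
      (X * σ.whittakerProj ψ).trace • σ.whittakerProj ψ := by
  by_cases he : σ.whittakerProj ψ = 0
  · simp [he]
  · rw [← hσ.trace_smul_whittakerProj_mul hψ, hσ.trace_whittakerProj hψ he, one_smul]

/-- The Fourier coefficient of a function on the general linear group. -/
noncomputable def FinRep.fourier (τ : FinRep n F) (f : (Matrix (Fin n) (Fin n) F)ˣ → ℂ) :
    Matrix (Fin τ.d) (Fin τ.d) ℂ :=
  ∑ h, f h • τ.mat h⁻¹

theorem IsBiWhittaker.whittakerProj_mul_fourier {ψ : AddChar F ℂ}
    {f : (Matrix (Fin n) (Fin n) F)ˣ → ℂ} (hf : IsBiWhittaker ψ f) (τ : FinRep n F) :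
    τ.whittakerProj ψ * τ.fourier f = τ.fourier f := by
  have h : ∀ u ∈ unipUnits F n, (psiU ψ (u : Matrix (Fin n) (Fin n) F))⁻¹ • τ.mat u *
      τ.fourier f = τ.fourier f := by
    intro u hu
    rw [smul_mul_assoc, inv_smul_eq_iff₀ (psiU_ne_zero ψ _), FinRep.fourier, Finset.mul_sum,
      Finset.smul_sum, ← Equiv.sum_comp (Equiv.mulRight u)]
    refine Finset.sum_congr rfl fun x _ => ?_
    have := hf 1 x u (by simpa using IsUnipUpper.one) (mem_unipUnits.1 hu)
    rw [one_mul, Units.val_one, psiU_one, one_mul] at this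
    rw [Equiv.coe_mulRight, this, mul_smul_comm, ← map_mul, mul_inv_rev, mul_inv_cancel_left,
      smul_smul]
  rw [FinRep.whittakerProj, smul_mul_assoc, Finset.sum_mul, Finset.sum_congr rfl h,
    Finset.sum_const, card_unipUnits, ← Nat.cast_smul_eq_nsmul ℂ,
    inv_smul_smul₀ card_unipFinset_ne_zero]

theorem IsBiWhittaker.fourier_mul_whittakerProj {ψ : AddChar F ℂ}
    {f : (Matrix (Fin n) (Fin n) F)ˣ → ℂ} (hf : IsBiWhittaker ψ f) (τ : FinRep n F) :
    τ.fourier f * τ.whittakerProj ψ = τ.fourier f := by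
  have h : ∀ u ∈ unipUnits F n, τ.fourier f *
      ((psiU ψ (u : Matrix (Fin n) (Fin n) F))⁻¹ • τ.mat u) = τ.fourier f := by
    intro u hu
    rw [mul_smul_comm, inv_smul_eq_iff₀ (psiU_ne_zero ψ _), FinRep.fourier, Finset.sum_mul,
      Finset.smul_sum, ← Equiv.sum_comp (Equiv.mulLeft u)]
    refine Finset.sum_congr rfl fun x _ => ?_
    have := hf u x 1 (mem_unipUnits.1 hu) (by simpa using IsUnipUpper.one)
    rw [mul_one, Units.val_one, psiU_one, mul_one] at this
    rw [Equiv.coe_mulLeft, this, smul_mul_assoc, ← map_mul, mul_inv_rev, inv_mul_cancel_right,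
      smul_smul]
  rw [FinRep.whittakerProj, mul_smul_comm, Finset.mul_sum, Finset.sum_congr rfl h,
    Finset.sum_const, card_unipUnits, ← Nat.cast_smul_eq_nsmul ℂ,
    inv_smul_smul₀ card_unipFinset_ne_zero]

theorem isBiWhittaker_Bessel (ψ : AddChar F ℂ) (σ : FinRep n F) :
    IsBiWhittaker ψ fun g : (Matrix (Fin n) (Fin n) F)ˣ =>
      Bessel ψ σ (g : Matrix (Fin n) (Fin n) F) := by
  intro u g v hu hv
  beta_reduce
  rw [Bessel_coe, Bessel_coe, map_mul, map_mul, mul_assoc, FinRep.mat_mul_whittakerProj hv,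
    mul_smul_comm, Matrix.trace_smul, mul_assoc, Matrix.trace_mul_comm, mul_assoc,
    FinRep.whittakerProj_mul_mat hu, mul_smul_comm, Matrix.trace_smul]
  simp only [smul_eq_mul]
  ring

omit [Fintype F] [DecidableEq F] in
theorem IsUnipUpper.mul_mul_apply_corner {u v : Matrix (Fin n) (Fin n) F} (hu : IsUnipUpper u)
    (hv : IsUnipUpper v) (A : Matrix (Fin n) (Fin n) F) {i j : Fin n} (hi : (i : ℕ) + 1 = n)
    (hj : (j : ℕ) = 0) : (u * A * v) i j = A i j := by
  rw [Matrix.mul_apply, Finset.sum_eq_single j, hv.1, mul_one, Matrix.mul_apply,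
    Finset.sum_eq_single i, hu.1, one_mul]
  · intro k _ hk
    have := Fin.val_ne_of_ne hk
    rw [hu.2 i k (by omega), zero_mul]
  · simp
  · intro k _ hk
    have := Fin.val_ne_of_ne hk
    rw [hv.2 k j (by omega), mul_zero]
  · simp

omit [DecidableEq F] in
theorem IsBiWhittaker.mul_corner {ψ : AddChar F ℂ} {f : (Matrix (Fin n) (Fin n) F)ˣ → ℂ}
    (hf : IsBiWhittaker ψ f) {i j : Fin n} (hi : (i : ℕ) + 1 = n) (hj : (j : ℕ) = 0) :
    IsBiWhittaker ψ fun g =>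
      f g * ψ (((g⁻¹ : (Matrix (Fin n) (Fin n) F)ˣ) : Matrix (Fin n) (Fin n) F) i j) := by
  intro u g v hu hv
  beta_reduce
  rw [hf u g v hu hv, mul_inv_rev, mul_inv_rev, ← mul_assoc, Units.val_mul, Units.val_mul,
    hv.inv.mul_mul_apply_corner hu.inv _ hi hj]
  ring

theorem FinRep.Iso.fourier_eq_zero {σ τ : FinRep n F} (h : τ.Iso σ)
    {f : (Matrix (Fin n) (Fin n) F)ˣ → ℂ} (hf : σ.fourier f = 0) : τ.fourier f = 0 := by
  obtain ⟨e, he⟩ := h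
  have key : ∀ v, e ((τ.fourier f).mulVec v) = (σ.fourier f).mulVec (e v) := by
    intro v
    simp only [FinRep.fourier, Matrix.sum_mulVec, map_sum, Matrix.smul_mulVec, map_smul,
      ← FinRep.coe_ρ, he]
  refine Matrix.ext_of_mulVec_single fun i => e.injective ?_
  rw [key, hf, Matrix.zero_mulVec, Matrix.zero_mulVec, map_zero]

/-- The representation afforded by a simple module over the group algebra, in a basis. -/
noncomputable def FinRep.ofModule {M : Type*} [AddCommGroup M] [Module ℂ M]
    [Module (MonoidAlgebra ℂ (Matrix (Fin n) (Fin n) F)ˣ) M]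
    [IsScalarTower ℂ (MonoidAlgebra ℂ (Matrix (Fin n) (Fin n) F)ˣ) M] {d : ℕ}
    (b : Module.Basis (Fin d) ℂ M) : FinRep n F where
  d := d
  ρ := MonoidHom.toHomUnits <|
    (((LinearMap.toMatrixAlgEquiv b : _ →ₐ[ℂ] _).comp (Algebra.lsmul ℂ ℂ M) :
      MonoidAlgebra ℂ (Matrix (Fin n) (Fin n) F)ˣ →ₐ[ℂ] Matrix (Fin d) (Fin d) ℂ) :
        _ →* _).comp (MonoidAlgebra.of ℂ _)

section ofModule

variable {M : Type*} [AddCommGroup M] [Module ℂ M]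
  [Module (MonoidAlgebra ℂ (Matrix (Fin n) (Fin n) F)ˣ) M]
  [IsScalarTower ℂ (MonoidAlgebra ℂ (Matrix (Fin n) (Fin n) F)ˣ) M] {d : ℕ}
  (b : Module.Basis (Fin d) ℂ M)

variable (F n) in
/-- The coordinate isomorphism from a module to the space of the representation it affords. -/
noncomputable def FinRep.ofModuleEquiv :
    M ≃ₗ[ℂ] (Fin (FinRep.ofModule (F := F) (n := n) b).d → ℂ) :=
  b.equivFun

omit [Fintype F] [DecidableEq F] in
theorem FinRep.ofModule_mat_mulVec (g : (Matrix (Fin n) (Fin n) F)ˣ) (m : M) :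
    ((FinRep.ofModule b).mat g).mulVec (FinRep.ofModuleEquiv F n b m) =
      FinRep.ofModuleEquiv F n b (MonoidAlgebra.of ℂ (Matrix (Fin n) (Fin n) F)ˣ g • m) :=
  LinearMap.toMatrix_mulVec_repr b b _ m

omit [Fintype F] [DecidableEq F] in
theorem FinRep.ofModule_irreducible
    [IsSimpleModule (MonoidAlgebra ℂ (Matrix (Fin n) (Fin n) F)ˣ) M] :
    (FinRep.ofModule (F := F) (n := n) b).Irreducible := by
  have : Nontrivial M :=
    IsSimpleModule.nontrivial (MonoidAlgebra ℂ (Matrix (Fin n) (Fin n) F)ˣ) M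
  refine ⟨?_, fun W hW => ?_⟩
  · have := b.index_nonempty
    exact Fin.pos_iff_nonempty.2 this
  · let N : Submodule (MonoidAlgebra ℂ (Matrix (Fin n) (Fin n) F)ˣ) M :=
      { carrier := {m | FinRep.ofModuleEquiv F n b m ∈ W}
        add_mem' := fun {x y} hx hy => by
          rw [Set.mem_ofPred_eq, map_add]
          exact W.add_mem hx hy
        zero_mem' := by simp
        smul_mem' := fun a m hm => by
          induction a using MonoidAlgebra.induction_on with
          | of g =>
            rw [Set.mem_ofPred_eq, ← FinRep.ofModule_mat_mulVec]
            exact hW g _ hm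
          | add x y hx hy =>
            rw [Set.mem_ofPred_eq, add_smul, map_add]
            exact W.add_mem hx hy
          | smul c x hx =>
            rw [Set.mem_ofPred_eq, smul_assoc, LinearEquiv.map_smul]
            exact W.smul_mem c hx }
    have hN : ∀ v, v ∈ W ↔ (FinRep.ofModuleEquiv F n b).symm v ∈ N := by
      intro v
      change _ ↔ FinRep.ofModuleEquiv F n b ((FinRep.ofModuleEquiv F n b).symm v) ∈ W
      rw [LinearEquiv.apply_symm_apply]
    rcases eq_bot_or_eq_top N with h | h
    · refine Or.inl (Submodule.ext fun v => ?_)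
      refine (hN v).trans ?_
      rw [h, Submodule.mem_bot, LinearEquiv.map_eq_zero_iff, Submodule.mem_bot]
    · refine Or.inr (Submodule.ext fun v => ?_)
      simp [hN, h]

end ofModule

/-- A function all of whose Fourier coefficients at irreducible representations vanish is zero. -/
theorem eq_zero_of_fourier_eq_zero {f : (Matrix (Fin n) (Fin n) F)ˣ → ℂ}
    (hf : ∀ τ : FinRep n F, τ.Irreducible → τ.fourier f = 0) : f = 0 := by
  let A := MonoidAlgebra ℂ (Matrix (Fin n) (Fin n) F)ˣ
  let a : A := ∑ h, f h • MonoidAlgebra.of ℂ (Matrix (Fin n) (Fin n) F)ˣ h⁻¹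
  have ha : a = 0 := by
    have hJ : Module.jacobson A A = ⊥ := IsSemisimpleModule.jacobson_eq_bot A A
    rw [← Submodule.mem_bot A, ← hJ, Module.jacobson, Submodule.mem_sInf]
    intro I hI
    have : IsSimpleModule A (A ⧸ I) := isSimpleModule_iff_isCoatom.2 hI
    have : Module.Finite ℂ (A ⧸ I) := Module.Finite.trans A _
    let b := Module.finBasis ℂ (A ⧸ I)
    have h0 := hf _ (FinRep.ofModule_irreducible b)
    have h1 : ((FinRep.ofModule b).fourier f).mulVec
        (FinRep.ofModuleEquiv F n b (Submodule.Quotient.mk 1)) =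
          FinRep.ofModuleEquiv F n b (a • Submodule.Quotient.mk 1) := by
      rw [FinRep.fourier, Matrix.sum_mulVec, Finset.sum_smul, map_sum]
      refine Finset.sum_congr rfl fun g _ => ?_
      rw [Matrix.smul_mulVec, FinRep.ofModule_mat_mulVec, smul_assoc, LinearEquiv.map_smul]
    have h2 : a • (Submodule.Quotient.mk 1 : A ⧸ I) = 0 := by
      refine (FinRep.ofModuleEquiv F n b).injective ?_
      rw [← h1, h0, Matrix.zero_mulVec, map_zero]
    rwa [← Submodule.Quotient.mk_smul, smul_eq_mul, mul_one, Submodule.Quotient.mk_eq_zero] at h2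
  funext g
  have : (∑ h, f h • MonoidAlgebra.of ℂ (Matrix (Fin n) (Fin n) F)ˣ h⁻¹).coeff g⁻¹ = 0 := by
    change a.coeff g⁻¹ = 0
    rw [ha]
    rfl
  simpa [Finsupp.single_apply] using this

/-- A bi-Whittaker function all of whose Bessel coefficients vanish is zero. -/
theorem IsBiWhittaker.eq_zero {ψ : AddChar F ℂ} (hψ : ψ ≠ 1)
    {f : (Matrix (Fin n) (Fin n) F)ˣ → ℂ} (hf : IsBiWhittaker ψ f)
    {ι : Type*} {σ : ι → FinRep n F} (hσ : ∀ i, (σ i).Irreducible)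
    (hcomplete : ∀ τ : FinRep n F, τ.Irreducible → τ.Generic ψ → ∃ i, τ.Iso (σ i))
    (h : ∀ i, ∑ g, f g * (starRingEnd ℂ) (Bessel ψ (σ i) (g : Matrix (Fin n) (Fin n) F)) = 0) :
    f = 0 := by
  refine eq_zero_of_fourier_eq_zero fun τ hτ => ?_
  by_cases he : τ.whittakerProj ψ = 0
  · rw [← hf.whittakerProj_mul_fourier, he, zero_mul]
  obtain ⟨i, hi⟩ := hcomplete τ hτ (FinRep.generic_of_whittakerProj_ne_zero he)
  refine hi.fourier_eq_zero ?_
  have htr : ((σ i).fourier f * (σ i).whittakerProj ψ).trace = 0 := by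
    rw [← h i, FinRep.fourier, Finset.sum_mul, Matrix.trace_sum]
    refine Finset.sum_congr rfl fun g _ => ?_
    rw [smul_mul_assoc, Matrix.trace_smul, smul_eq_mul, conj_Bessel_coe]
  have := (hσ i).whittakerProj_mul_mul hψ ((σ i).fourier f)
  rwa [htr, zero_smul, hf.whittakerProj_mul_fourier, hf.fourier_mul_whittakerProj] at this

/-- Orthogonality of the Bessel functions of non-isomorphic representations. -/
theorem sum_Bessel_mul_conj_Bessel_of_not_iso {ψ : AddChar F ℂ} {σ τ : FinRep n F}
    (hσ : σ.Irreducible) (hτ : τ.Irreducible) (hne : ¬ τ.Iso σ) :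
    ∑ g : (Matrix (Fin n) (Fin n) F)ˣ, Bessel ψ σ (g : Matrix (Fin n) (Fin n) F) *
      (starRingEnd ℂ) (Bessel ψ τ (g : Matrix (Fin n) (Fin n) F)) = 0 := by
  simp_rw [conj_Bessel_coe, Bessel_coe]
  exact FinRep.sum_trace_mul_trace_of_not_iso hσ hτ hne _ _

theorem sum_Bessel_mul_conj_Bessel_self {ψ : AddChar F ℂ} (hψ : ψ ≠ 1) {σ : FinRep n F}
    (hσ : σ.Irreducible) (hgen : σ.Generic ψ) :
    ∑ g : (Matrix (Fin n) (Fin n) F)ˣ, Bessel ψ σ (g : Matrix (Fin n) (Fin n) F) *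
      (starRingEnd ℂ) (Bessel ψ σ (g : Matrix (Fin n) (Fin n) F)) =
        (Fintype.card (Matrix (Fin n) (Fin n) F)ˣ : ℂ) / σ.d := by
  simp_rw [conj_Bessel_coe, Bessel_coe]
  rw [hσ.sum_trace_mul_trace, FinRep.whittakerProj_mul_self,
    hσ.trace_whittakerProj hψ hgen.whittakerProj_ne_zero, mul_one]

/-- The expansion of a bi-Whittaker function in Bessel functions. -/
theorem IsBiWhittaker.eq_sum_Bessel {ψ : AddChar F ℂ} (hψ : ψ ≠ 1)
    {f : (Matrix (Fin n) (Fin n) F)ˣ → ℂ} (hf : IsBiWhittaker ψ f)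
    {ι : Type*} [Fintype ι] {σ : ι → FinRep n F}
    (hσ : ∀ i, (σ i).Irreducible ∧ (σ i).Generic ψ)
    (hpairwise : ∀ i j, (σ i).Iso (σ j) → i = j)
    (hcomplete : ∀ τ : FinRep n F, τ.Irreducible → τ.Generic ψ → ∃ i, τ.Iso (σ i))
    (g : (Matrix (Fin n) (Fin n) F)ˣ) :
    f g = ∑ i, ((σ i).d : ℂ) / (Fintype.card (Matrix (Fin n) (Fin n) F)ˣ : ℂ) *
      (∑ h, f h * (starRingEnd ℂ) (Bessel ψ (σ i) (h : Matrix (Fin n) (Fin n) F))) *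
        Bessel ψ (σ i) (g : Matrix (Fin n) (Fin n) F) := by
  set c : ι → ℂ := fun i => ((σ i).d : ℂ) / (Fintype.card (Matrix (Fin n) (Fin n) F)ˣ : ℂ) *
      (∑ h, f h * (starRingEnd ℂ) (Bessel ψ (σ i) (h : Matrix (Fin n) (Fin n) F)))
  have hF : IsBiWhittaker ψ fun g =>
      f g - ∑ i, c i * Bessel ψ (σ i) (g : Matrix (Fin n) (Fin n) F) := by
    intro u g v hu hv
    beta_reduce
    rw [hf u g v hu hv, mul_sub, Finset.mul_sum]
    congr 1
    refine Finset.sum_congr rfl fun i _ => ?_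
    have := isBiWhittaker_Bessel ψ (σ i) u g v hu hv
    beta_reduce at this
    rw [this]
    ring
  refine sub_eq_zero.1 (congrFun (hF.eq_zero hψ (fun i => (hσ i).1) hcomplete fun j => ?_) g)
  simp_rw [sub_mul, Finset.sum_mul]
  rw [Finset.sum_sub_distrib, Finset.sum_comm]
  simp_rw [mul_assoc, ← Finset.mul_sum]
  rw [Finset.sum_eq_single j, sum_Bessel_mul_conj_Bessel_self hψ (hσ j).1 (hσ j).2]
  · have hd : ((σ j).d : ℂ) ≠ 0 := Nat.cast_ne_zero.2 (hσ j).1.1.ne'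
    have hG : (Fintype.card (Matrix (Fin n) (Fin n) F)ˣ : ℂ) ≠ 0 :=
      Nat.cast_ne_zero.2 Fintype.card_ne_zero
    simp only [c]
    field_simp
    ring
  · intro i _ hij
    rw [sum_Bessel_mul_conj_Bessel_of_not_iso (hσ i).1 (hσ j).1 fun h => hij (hpairwise _ _ h).symm,
      mul_zero]
  · simp

end Fourier

/-- the recursive expression for the Bessel function of an irreducible generic
representation of `GL_n(F)` in the case `m = n`. -/
theorem bessel_recursive_eq
    (F : Type) [Field F] [Fintype F] [DecidableEq F]
    (ψ : AddChar F ℂ) (hψ : ψ ≠ 1)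
    (n : ℕ) (hn : 1 ≤ n)
    (π : FinRep n F) (hπirr : π.Irreducible) (hπgen : π.Generic ψ)
    (ι : Type) [Fintype ι] (σ : ι → FinRep n F)
    (hσ : ∀ i, (σ i).Irreducible ∧ (σ i).Generic ψ)
    (hpairwise : ∀ i j, (σ i).Iso (σ j) → i = j)
    (hcomplete : ∀ τ : FinRep n F, τ.Irreducible → τ.Generic ψ → ∃ i, τ.Iso (σ i))
    (g : (Matrix (Fin n) (Fin n) F)ˣ) :
    Bessel ψ π (g : Matrix (Fin n) (Fin n) F) *
        ψ ((g⁻¹ : (Matrix (Fin n) (Fin n) F)ˣ) ⟨n - 1, by omega⟩ ⟨0, by omega⟩) =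
      (((unipFinset F n).card : ℂ) / (Fintype.card (Matrix (Fin n) (Fin n) F)ˣ : ℂ)) *
        ∑ i : ι, ((σ i).d : ℂ) *
          (((unipFinset F n).card : ℂ)⁻¹ *
            ∑ h : (Matrix (Fin n) (Fin n) F)ˣ,
              Bessel ψ π (h : Matrix (Fin n) (Fin n) F) *
                (starRingEnd ℂ) (Bessel ψ (σ i) (h : Matrix (Fin n) (Fin n) F)) *
                ψ ((h⁻¹ : (Matrix (Fin n) (Fin n) F)ˣ) ⟨n - 1, by omega⟩ ⟨0, by omega⟩)) *
          Bessel ψ (σ i) (g : Matrix (Fin n) (Fin n) F) := by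
  have hf := (isBiWhittaker_Bessel ψ π).mul_corner
    (i := ⟨n - 1, by omega⟩) (j := ⟨0, by omega⟩) (Nat.sub_add_cancel hn) rfl
  refine (hf.eq_sum_Bessel hψ hσ hpairwise hcomplete g).trans ?_
  rw [Finset.mul_sum]
  refine Finset.sum_congr rfl fun i _ => ?_
  have hU := card_unipFinset_ne_zero (F := F) (n := n)
  simp_rw [mul_right_comm (Bessel ψ π _)]
  field_simp
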